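/- arXiv:quant-ph/0606211 — 7 statements merged into one kernel-verified Lean document; each statement's English description precedes it below -/
import Mathlib

section
/- Let d ≥ 2 and let a = (a_{ij}) be a real d×d matrix with nonnegative entries. The linear map φ_a is positive (i.e., maps positive semidefinite matrices to positive semidefinite matrices) if and only if for every x ∈ ℂ^d with ‖x‖ = 1 such that B_i(x) > 0 for every i, one has Σ_{i=1}^d |x_i|²/B_i(x) ≤ 1. -/
open Matrix BigOperators ComplexOrder

noncomputable section

/-- The map `φ_a` determined by a real `d × d` matrix `a`:
`(φ_a X)_{ii} = ∑_j a_{ij} X_{jj}` and `(φ_a X)_{ij} = -X_{ij}` for `i ≠ j`. -/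
def phiA {d : ℕ} (a : Matrix (Fin d) (Fin d) ℝ) (X : Matrix (Fin d) (Fin d) ℂ) :
    Matrix (Fin d) (Fin d) ℂ :=
  Matrix.of fun i j => if i = j then ∑ k, (a i k : ℂ) * X k k else -X i j

lemma star_mul_eq (z : ℂ) : star z * z = ((‖z‖ ^ 2 : ℝ) : ℂ) := by
  have := Complex.conj_mul' z
  simpa using this

lemma mul_star_eq (z : ℂ) : z * star z = ((‖z‖ ^ 2 : ℝ) : ℂ) := by
  have := Complex.mul_conj' z
  simpa using this

lemma phiA_rank {d : ℕ} (a : Matrix (Fin d) (Fin d) ℝ) (x : Fin d → ℂ) :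
    phiA a (vecMulVec x (star x)) =
      diagonal (fun i => ((‖x i‖ ^ 2 + ∑ j, a i j * ‖x j‖ ^ 2 : ℝ) : ℂ)) -
        vecMulVec x (star x) := by
  ext i j
  by_cases h : i = j
  · subst h
    simp only [phiA, of_apply, if_true, vecMulVec_apply, Pi.star_apply, Matrix.sub_apply,
      diagonal_apply_eq, mul_star_eq]
    push_cast
    ring
  · simp [phiA, h]

lemma phiA_quad {d : ℕ} (a : Matrix (Fin d) (Fin d) ℝ) (x y : Fin d → ℂ) :
    star y ⬝ᵥ (phiA a (vecMulVec x (star x)) *ᵥ y) =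
      ((∑ i, (‖x i‖ ^ 2 + ∑ j, a i j * ‖x j‖ ^ 2) * ‖y i‖ ^ 2
        - ‖∑ i, star (y i) * x i‖ ^ 2 : ℝ) : ℂ) := by
  rw [phiA_rank, sub_mulVec, dotProduct_sub, Complex.ofReal_sub]
  congr 1
  · simp only [dotProduct, mulVec_diagonal, Pi.star_apply]
    rw [Complex.ofReal_sum]
    refine Finset.sum_congr rfl fun i _ => ?_
    rw [mul_left_comm, star_mul_eq, Complex.ofReal_mul]
  · rw [← mul_star_eq, vecMulVec_mulVec, dotProduct_smul]
    simp only [dotProduct, star_sum, star_mul', star_star, Pi.star_apply]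
    simp [mul_comm]

lemma phiA_sum {d m : ℕ} (a : Matrix (Fin d) (Fin d) ℝ)
    (V : Fin m → Matrix (Fin d) (Fin d) ℂ) :
    phiA a (∑ k, V k) = ∑ k, phiA a (V k) := by
  ext i j
  rw [Matrix.sum_apply]
  by_cases h : i = j
  · subst h
    simp only [phiA, of_apply, if_true, Matrix.sum_apply, Finset.mul_sum]
    rw [Finset.sum_comm]
  · simp [phiA, h, Matrix.sum_apply]

lemma rank_ineq {d : ℕ} (hd : 2 ≤ d) (a : Matrix (Fin d) (Fin d) ℝ)
    (ha : ∀ i j, 0 ≤ a i j)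
    (H : ∀ x : Fin d → ℂ, (∑ i, ‖x i‖ ^ 2) = 1 →
        (∀ i, 0 < ‖x i‖ ^ 2 + ∑ j, a i j * ‖x j‖ ^ 2) →
        ∑ i, ‖x i‖ ^ 2 / (‖x i‖ ^ 2 + ∑ j, a i j * ‖x j‖ ^ 2) ≤ 1)
    (x y : Fin d → ℂ) (hx : ∀ i, x i ≠ 0) :
    ‖∑ i, star (y i) * x i‖ ^ 2 ≤
      ∑ i, (‖x i‖ ^ 2 + ∑ j, a i j * ‖x j‖ ^ 2) * ‖y i‖ ^ 2 := by
  set D : Fin d → ℝ := fun i => ‖x i‖ ^ 2 + ∑ j, a i j * ‖x j‖ ^ 2 with hD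
  have hpos : ∀ i, 0 < ‖x i‖ ^ 2 := fun i => by have := norm_pos_iff.2 (hx i); positivity
  have hDp : ∀ i, 0 < D i := fun i =>
    add_pos_of_pos_of_nonneg (hpos i)
      (Finset.sum_nonneg fun j _ => mul_nonneg (ha i j) (by positivity))
  set c : ℝ := ∑ i, ‖x i‖ ^ 2 with hc
  have hcp : 0 < c := Finset.sum_pos (fun i _ => hpos i) ⟨⟨0, by omega⟩, Finset.mem_univ _⟩
  have hn : ∀ i, ‖(((√c)⁻¹ : ℝ) : ℂ) * x i‖ ^ 2 = c⁻¹ * ‖x i‖ ^ 2 := fun i => by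
    rw [norm_mul, mul_pow, Complex.norm_real, Real.norm_eq_abs, sq_abs, inv_pow,
      Real.sq_sqrt hcp.le]
  have hB : ∀ i, c⁻¹ * ‖x i‖ ^ 2 + ∑ j, a i j * (c⁻¹ * ‖x j‖ ^ 2) = c⁻¹ * D i := fun i => by
    simp only [hD, mul_add, Finset.mul_sum]
    congr 1
    exact Finset.sum_congr rfl fun j _ => by ring
  have h1 := H (fun i => (((√c)⁻¹ : ℝ) : ℂ) * x i)
  simp only [hn, hB] at h1
  have hS : ∑ i, ‖x i‖ ^ 2 / D i ≤ 1 := by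
    have h2 := h1 (by rw [← Finset.mul_sum, ← hc]; exact inv_mul_cancel₀ hcp.ne')
      (fun i => mul_pos (inv_pos.2 hcp) (hDp i))
    refine le_trans (le_of_eq ?_) h2
    exact Finset.sum_congr rfl fun i _ => (mul_div_mul_left _ _ (inv_pos.2 hcp).ne').symm
  have hCS : (∑ i, ‖y i‖ * ‖x i‖) ^ 2 ≤ (∑ i, D i * ‖y i‖ ^ 2) * ∑ i, ‖x i‖ ^ 2 / D i := by
    refine Finset.sum_sq_le_sum_mul_sum_of_sq_eq_mul _ (fun i _ => ?_) (fun i _ => ?_)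
      (fun i _ => ?_)
    · have := (hDp i).le; positivity
    · have := (hDp i).le; positivity
    · have := (hDp i).ne'; field_simp
  have hE : 0 ≤ ∑ i, D i * ‖y i‖ ^ 2 :=
    Finset.sum_nonneg fun i _ => mul_nonneg (hDp i).le (by positivity)
  calc ‖∑ i, star (y i) * x i‖ ^ 2 ≤ (∑ i, ‖y i‖ * ‖x i‖) ^ 2 := by
        gcongr
        refine (norm_sum_le _ _).trans (le_of_eq ?_)
        simp
    _ ≤ _ := hCS
    _ ≤ _ := mul_le_of_le_one_right hE hS

lemma rank_ineq' {d : ℕ} (hd : 2 ≤ d) (a : Matrix (Fin d) (Fin d) ℝ)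
    (ha : ∀ i j, 0 ≤ a i j)
    (H : ∀ x : Fin d → ℂ, (∑ i, ‖x i‖ ^ 2) = 1 →
        (∀ i, 0 < ‖x i‖ ^ 2 + ∑ j, a i j * ‖x j‖ ^ 2) →
        ∑ i, ‖x i‖ ^ 2 / (‖x i‖ ^ 2 + ∑ j, a i j * ‖x j‖ ^ 2) ≤ 1)
    (x y : Fin d → ℂ) :
    ‖∑ i, star (y i) * x i‖ ^ 2 ≤
      ∑ i, (‖x i‖ ^ 2 + ∑ j, a i j * ‖x j‖ ^ 2) * ‖y i‖ ^ 2 := by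
  have hdense : Dense (Set.univ.pi fun _ : Fin d => ({0}ᶜ : Set ℂ)) :=
    dense_pi _ fun i _ => dense_compl_singleton 0
  have hcl : IsClosed {x : Fin d → ℂ | ‖∑ i, star (y i) * x i‖ ^ 2 ≤
      ∑ i, (‖x i‖ ^ 2 + ∑ j, a i j * ‖x j‖ ^ 2) * ‖y i‖ ^ 2} :=
    isClosed_le (by fun_prop) (by fun_prop)
  have hsub := hcl.closure_subset_iff.2 (fun x (hx : x ∈ Set.univ.pi fun _ : Fin d => ({0}ᶜ : Set ℂ)) =>
    rank_ineq hd a ha H x y (fun i => by simpa using hx i (Set.mem_univ i)))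
  exact hsub (hdense x)

theorem stmt0 {d : ℕ} (hd : 2 ≤ d) (a : Matrix (Fin d) (Fin d) ℝ)
    (ha : ∀ i j, 0 ≤ a i j) :
    (∀ X : Matrix (Fin d) (Fin d) ℂ, X.PosSemidef → (phiA a X).PosSemidef) ↔
      ∀ x : Fin d → ℂ, (∑ i, ‖x i‖ ^ 2) = 1 →
        (∀ i, 0 < ‖x i‖ ^ 2 + ∑ j, a i j * ‖x j‖ ^ 2) →
        ∑ i, ‖x i‖ ^ 2 / (‖x i‖ ^ 2 + ∑ j, a i j * ‖x j‖ ^ 2) ≤ 1 := by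
  constructor
  · intro h x _ hp
    have h1 := (h _ (posSemidef_vecMulVec_self_star x)).dotProduct_mulVec_nonneg
      (fun i => x i / ((‖x i‖ ^ 2 + ∑ j, a i j * ‖x j‖ ^ 2 : ℝ) : ℂ))
    rw [phiA_quad, Complex.zero_le_real] at h1
    set D : Fin d → ℝ := fun i => ‖x i‖ ^ 2 + ∑ j, a i j * ‖x j‖ ^ 2 with hD
    change ∀ i, 0 < D i at hp
    change 0 ≤ ∑ i, D i * ‖x i / (D i : ℂ)‖ ^ 2 - ‖∑ i, star (x i / (D i : ℂ)) * x i‖ ^ 2 at h1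
    change ∑ i, ‖x i‖ ^ 2 / D i ≤ 1
    have e1 : ∑ i, D i * ‖x i / (D i : ℂ)‖ ^ 2 = ∑ i, ‖x i‖ ^ 2 / D i :=
      Finset.sum_congr rfl fun i _ => by
        have := (hp i).ne'
        rw [norm_div, div_pow, Complex.norm_real, Real.norm_eq_abs, sq_abs]
        field_simp
    have e2 : ∑ i, star (x i / (D i : ℂ)) * x i = ((∑ i, ‖x i‖ ^ 2 / D i : ℝ) : ℂ) := by
      rw [Complex.ofReal_sum]
      refine Finset.sum_congr rfl fun i _ => ?_
      rw [Complex.ofReal_div, ← star_mul_eq]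
      simp [div_mul_eq_mul_div]
    rw [e1, e2, Complex.norm_real, Real.norm_eq_abs, sq_abs] at h1
    nlinarith
  · intro H X hX
    obtain ⟨m, v, rfl⟩ := posSemidef_iff_eq_sum_vecMulVec.1 hX
    rw [phiA_sum]
    refine posSemidef_sum _ fun k _ => ?_
    refine PosSemidef.of_dotProduct_mulVec_nonneg ?_ fun y => ?_
    · rw [phiA_rank]
      refine IsHermitian.sub ?_ (posSemidef_vecMulVec_self_star _).1
      refine isHermitian_diagonal_of_self_adjoint _ ?_
      ext i
      simp
    · rw [phiA_quad, Complex.zero_le_real, sub_nonneg]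
      exact rank_ineq' hd a ha H _ y
end
end

section
/- Let d ≥ 1, let a = (a_{ij}) be a real d×d matrix, and let x ∈ ℂ^d. Let A(x) be the d×d complex matrix with A(x)_{ii} = Σ_{j=1}^d a_{ij}|x_j|² and A(x)_{ij} = −x_i · conj(x_j) for i ≠ j, and set B_i(x) = |x_i|² + Σ_{j=1}^d a_{ij}|x_j|². Then for every λ ∈ ℂ with λ ≠ B_k(x) for all k, det(A(x) − λ·I_d) = (1 − Σ_{k=1}^d |x_k|²/(B_k(x) − λ)) · ∏_{i=1}^d (B_i(x) − λ). -/
open Matrix BigOperators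

theorem stmt2 {d : ℕ} (hd : 1 ≤ d) (a : Matrix (Fin d) (Fin d) ℝ) (x : Fin d → ℂ)
    (lam : ℂ)
    (hlam : ∀ k : Fin d, lam ≠ ((‖x k‖ ^ 2 + ∑ j, a k j * ‖x j‖ ^ 2 : ℝ) : ℂ)) :
    ((Matrix.of fun i j : Fin d =>
        if i = j then ((∑ l, a i l * ‖x l‖ ^ 2 : ℝ) : ℂ) else -(x i * star (x j)))
      - lam • (1 : Matrix (Fin d) (Fin d) ℂ)).det =
    (1 - ∑ i, ((‖x i‖ ^ 2 : ℝ) : ℂ) /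
        (((‖x i‖ ^ 2 + ∑ j, a i j * ‖x j‖ ^ 2 : ℝ) : ℂ) - lam)) *
      ∏ i, (((‖x i‖ ^ 2 + ∑ j, a i j * ‖x j‖ ^ 2 : ℝ) : ℂ) - lam) := by
  have hx : ∀ i, ((‖x i‖ ^ 2 : ℝ) : ℂ) = x i * star (x i) := by
    intro i
    have h := Complex.mul_conj' (x i)
    push_cast
    exact h.symm
  have hne : ∀ i, (((‖x i‖ ^ 2 + ∑ j, a i j * ‖x j‖ ^ 2 : ℝ) : ℂ) - lam) ≠ 0 :=
    fun i => sub_ne_zero.mpr (hlam i).symm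
  have hD : ∀ i, (((‖x i‖ ^ 2 + ∑ j, a i j * ‖x j‖ ^ 2 : ℝ) : ℂ) - lam)
      = x i * star (x i) + ((∑ l, a i l * ‖x l‖ ^ 2 : ℝ) : ℂ) - lam := by
    intro i
    rw [Complex.ofReal_add, hx]
  simp only [hx]
  simp only [hD] at hne ⊢
  generalize hc : (fun i => ((∑ l, a i l * ‖x l‖ ^ 2 : ℝ) : ℂ)) = c at *
  have hc' : ∀ i, ((∑ l, a i l * ‖x l‖ ^ 2 : ℝ) : ℂ) = c i := fun i => congrFun hc i
  simp only [hc'] at hne ⊢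
  have key : ((Matrix.of fun i j : Fin d => if i = j then c i else -(x i * star (x j)))
      - lam • (1 : Matrix (Fin d) (Fin d) ℂ))
      = Matrix.diagonal (fun i => x i * star (x i) + c i - lam) *
        (1 + Matrix.replicateCol Unit (fun i => -(x i / (x i * star (x i) + c i - lam))) *
          Matrix.replicateRow Unit (fun j => star (x j))) := by
    ext i j
    have h := hne i
    rw [Matrix.diagonal_mul]
    simp only [Matrix.sub_apply, Matrix.of_apply, Matrix.smul_apply, Matrix.add_apply,
      Matrix.mul_apply, Matrix.replicateCol_apply, Matrix.replicateRow_apply,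
      Finset.univ_unique, Finset.sum_singleton, Matrix.one_apply, smul_eq_mul]
    by_cases hij : i = j
    · subst hij
      simp only [if_true]
      generalize star (x i) = y at *
      field_simp
      ring
    · simp only [hij, if_false]
      generalize star (x i) = y at *
      field_simp
      ring
  rw [key, Matrix.det_mul, Matrix.det_diagonal, Matrix.det_one_add_replicateCol_mul_replicateRow,
    mul_comm, sub_eq_add_neg, ← Finset.sum_neg_distrib]
  congr 2
  simp only [dotProduct]
  refine Finset.sum_congr rfl fun i _ => ?_
  ring
end

section
/- Let d ≥ 1, let a = (a_{ij}) be a real d×d matrix with nonnegative entries, and let x ∈ ℂ^d be such that B_i(x) > 0 for every i. Then the Hermitian matrix A(x), with entries A(x)_{ii} = Σ_{j} a_{ij}|x_j|² and A(x)_{ij} = −x_i·conj(x_j) for i ≠ j, is positive semidefinite if and only if Σ_{i=1}^d |x_i|²/B_i(x) ≤ 1. -/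
open Matrix BigOperators ComplexOrder

lemma aux_quad {d : ℕ} (B : Fin d → ℝ) (x v : Fin d → ℂ) :
    star v ⬝ᵥ ((diagonal (fun i => (B i : ℂ)) - vecMulVec x (star x)) *ᵥ v)
      = ((∑ i, B i * ‖v i‖ ^ 2 - ‖∑ i, star (x i) * v i‖ ^ 2 : ℝ) : ℂ) := by
  have h1 : star v ⬝ᵥ x = star (∑ i, star (x i) * v i) := by
    simp [dotProduct, star_sum, mul_comm]
  have h2 : star x ⬝ᵥ v = ∑ i, star (x i) * v i := rfl
  rw [sub_mulVec, dotProduct_sub, vecMulVec_mulVec, dotProduct_smul, h1, h2]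
  push_cast
  congr 1
  · simp only [dotProduct, mulVec_diagonal, Pi.star_apply]
    refine Finset.sum_congr rfl fun i _ => ?_
    rw [← Complex.conj_mul']
    simp only [RCLike.star_def]
    ring
  · rw [← Complex.conj_mul']
    simp [mul_comm]

theorem stmt3 {d : ℕ} (hd : 1 ≤ d) (a : Matrix (Fin d) (Fin d) ℝ)
    (ha : ∀ i j, 0 ≤ a i j) (x : Fin d → ℂ)
    (hB : ∀ i, 0 < ‖x i‖ ^ 2 + ∑ j, a i j * ‖x j‖ ^ 2) :
    (Matrix.of fun i j : Fin d =>
        if i = j then ((∑ l, a i l * ‖x l‖ ^ 2 : ℝ) : ℂ)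
        else -(x i * star (x j))).PosSemidef ↔
      ∑ i, ‖x i‖ ^ 2 / (‖x i‖ ^ 2 + ∑ j, a i j * ‖x j‖ ^ 2) ≤ 1 := by
  have hM : (Matrix.of fun i j : Fin d =>
        if i = j then ((∑ l, a i l * ‖x l‖ ^ 2 : ℝ) : ℂ)
        else -(x i * star (x j))) =
      diagonal (fun i => ((‖x i‖ ^ 2 + ∑ j, a i j * ‖x j‖ ^ 2 : ℝ) : ℂ))
        - vecMulVec x (star x) := by
    ext i j
    by_cases h : i = j
    · subst h
      have := Complex.mul_conj' (x i)
      simp [vecMulVec_apply, this]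
    · simp [h, vecMulVec_apply]
  rw [hM]
  set B : Fin d → ℝ := fun i => ‖x i‖ ^ 2 + ∑ j, a i j * ‖x j‖ ^ 2 with hBd
  change ∀ i, 0 < B i at hB
  change (diagonal (fun i => (B i : ℂ)) - vecMulVec x (star x)).PosSemidef ↔
    ∑ i, ‖x i‖ ^ 2 / B i ≤ 1
  clear_value B
  rw [posSemidef_iff_dotProduct_mulVec]
  simp only [aux_quad, Complex.zero_le_real]
  constructor
  · rintro ⟨-, h⟩
    have := h (fun i => x i / B i)
    have e1 : ∑ i, B i * ‖x i / (B i : ℂ)‖ ^ 2 = ∑ i, ‖x i‖ ^ 2 / B i := by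
      refine Finset.sum_congr rfl fun i _ => ?_
      have := (hB i).ne'
      rw [norm_div, Complex.norm_real, div_pow, Real.norm_eq_abs, sq_abs]
      field_simp
    have e2 : ∑ i, star (x i) * (x i / (B i : ℂ)) = ((∑ i, ‖x i‖ ^ 2 / B i : ℝ) : ℂ) := by
      push_cast
      refine Finset.sum_congr rfl fun i _ => ?_
      rw [← Complex.conj_mul', RCLike.star_def]
      ring
    rw [e1, e2, Complex.norm_real, Real.norm_eq_abs, sq_abs] at this
    nlinarith
  · intro h
    refine ⟨?_, fun v => ?_⟩
    · ext i j
      by_cases hij : i = j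
      · subst hij
        simp [vecMulVec_apply, mul_comm]
      · simp [vecMulVec_apply, mul_comm, hij, Ne.symm hij]
    · have c1 : ‖∑ i, star (x i) * v i‖ ≤ ∑ i, ‖x i‖ * ‖v i‖ := by
        refine (norm_sum_le _ _).trans_eq ?_
        simp
      have c2 : (∑ i, ‖x i‖ * ‖v i‖) ^ 2 ≤
          (∑ i, ‖x i‖ ^ 2 / B i) * ∑ i, B i * ‖v i‖ ^ 2 := by
        refine Finset.sum_sq_le_sum_mul_sum_of_sq_eq_mul _ (fun i _ => ?_) (fun i _ => ?_)
          (fun i _ => ?_)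
        · have := hB i
          positivity
        · have := hB i
          positivity
        · have := (hB i).ne'
          field_simp
      have c3 : 0 ≤ ∑ i, B i * ‖v i‖ ^ 2 :=
        Finset.sum_nonneg fun i _ => mul_nonneg (hB i).le (sq_nonneg _)
      have c4 := pow_le_pow_left₀ (norm_nonneg _) c1 2
      nlinarith
end

section
/- Let d ≥ 2 and let a = (a_{ij}) be a real d×d matrix with nonnegative entries. Define the real d×d matrix b by b_{ii} = a_{ii} and b_{ij} = −1 for i ≠ j. Then the map φ_a is completely positive if and only if b is positive semidefinite. -/
open Matrix BigOperators ComplexOrder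

noncomputable section

/-- `id_{M_n} ⊗ φ` : apply `φ` to each `d × d` block of an `n × n` block matrix. -/
def blockMap {n d : ℕ} (φ : Matrix (Fin d) (Fin d) ℂ → Matrix (Fin d) (Fin d) ℂ)
    (ρ : Matrix (Fin n × Fin d) (Fin n × Fin d) ℂ) :
    Matrix (Fin n × Fin d) (Fin n × Fin d) ℂ :=
  Matrix.of fun p q => φ (Matrix.of fun s t => ρ (p.1, s) (q.1, t)) p.2 q.2

/-- Complete positivity: every block extension preserves positive semidefiniteness. -/
def IsCP {d : ℕ} (φ : Matrix (Fin d) (Fin d) ℂ → Matrix (Fin d) (Fin d) ℂ) : Prop :=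
  ∀ n : ℕ, ∀ ρ : Matrix (Fin n × Fin d) (Fin n × Fin d) ℂ,
    ρ.PosSemidef → (blockMap φ ρ).PosSemidef

theorem psd_toComplex {d : ℕ} {B : Matrix (Fin d) (Fin d) ℝ} (hB : B.PosSemidef) :
    (Matrix.of fun i j => ((B i j : ℝ) : ℂ)).PosSemidef := by
  obtain ⟨m, v, rfl⟩ := Matrix.posSemidef_iff_eq_sum_vecMulVec.mp hB
  refine Matrix.posSemidef_iff_eq_sum_vecMulVec.mpr ⟨m, fun k i => ((v k i : ℝ) : ℂ), ?_⟩
  ext i j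
  simp [Matrix.sum_apply, Matrix.vecMulVec_apply]

theorem psd_ofComplex {d : ℕ} {B : Matrix (Fin d) (Fin d) ℝ}
    (hB : (Matrix.of fun i j => ((B i j : ℝ) : ℂ)).PosSemidef) : B.PosSemidef := by
  rw [Matrix.posSemidef_iff_dotProduct_mulVec] at hB ⊢
  refine ⟨?_, fun x => ?_⟩
  · ext i j
    have := congrFun (congrFun hB.1 i) j
    simpa [Matrix.conjTranspose_apply] using this
  · have := hB.2 (fun i => ((x i : ℝ) : ℂ))
    have h2 : (0 : ℂ) ≤ ((star x ⬝ᵥ (B *ᵥ x) : ℝ) : ℂ) := by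
      convert this using 1
      simp [dotProduct, Matrix.mulVec]
    exact_mod_cast h2

theorem stmt5 {d : ℕ} (hd : 2 ≤ d) (a : Matrix (Fin d) (Fin d) ℝ)
    (ha : ∀ i j, 0 ≤ a i j) :
    IsCP (phiA a) ↔
      (Matrix.of fun i j : Fin d =>
        if i = j then a i i else (-1 : ℝ)).PosSemidef := by
  constructor
  · intro h
    apply psd_ofComplex
    have h1 := h d _ (Matrix.posSemidef_vecMulVec_self_star
      (fun p : Fin d × Fin d => if p.1 = p.2 then (1 : ℂ) else 0))
    have h2 := h1.submatrix (fun i : Fin d => (i, i))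
    convert h2 using 1
    ext i j
    by_cases hij : i = j
    · subst hij
      simp [blockMap, phiA, Matrix.vecMulVec_apply]
    · simp [blockMap, phiA, Matrix.vecMulVec_apply, hij]
  · intro hB n ρ hρ
    have h1 := ((psd_toComplex hB).submatrix (fun p : Fin n × Fin d => p.2)).hadamard hρ
    have h2 : (∑ i : Fin d, ∑ k : Fin d, (if i = k then (0 : ℂ) else (a i k : ℂ)) •
        ((Matrix.vecMulVec (fun p : Fin n × Fin d => if p.2 = i then (1 : ℂ) else 0)
          (star (fun p : Fin n × Fin d => if p.2 = i then (1 : ℂ) else 0))).hadamard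
          (ρ.submatrix (fun p : Fin n × Fin d => (p.1, k))
            (fun p : Fin n × Fin d => (p.1, k))))).PosSemidef := by
      refine Matrix.posSemidef_sum _ fun i _ => Matrix.posSemidef_sum _ fun k _ => ?_
      refine Matrix.PosSemidef.smul
        ((Matrix.posSemidef_vecMulVec_self_star _).hadamard (hρ.submatrix _)) ?_
      split_ifs
      · exact le_rfl
      · exact_mod_cast ha i k
    have h3 : (_ : Matrix (Fin n × Fin d) (Fin n × Fin d) ℂ).PosSemidef :=
      Matrix.PosSemidef.add (R := ℂ) h1 h2
    refine (congrArg (fun M : Matrix (Fin n × Fin d) (Fin n × Fin d) ℂ => M.PosSemidef) ?_).mpr h3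
    ext ⟨p, i⟩ ⟨q, j⟩
    by_cases hij : i = j
    · subst hij
      simp only [blockMap, phiA, Matrix.vecMulVec_apply, Matrix.sum_apply, Matrix.add_apply,
        Matrix.of_apply, Matrix.smul_apply, Matrix.hadamard_apply, Matrix.submatrix_apply,
        Pi.star_apply, if_true, smul_eq_mul]
      rw [Finset.sum_eq_single (s := Finset.univ) (a := i)
        (f := fun x : Fin d => ∑ k : Fin d, _)]
      · rw [← Finset.add_sum_erase _ _ (Finset.mem_univ i)]
        congr 1
        rw [← Finset.add_sum_erase _ _ (Finset.mem_univ i)]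
        simp only [if_true, zero_mul, zero_add]
        refine Finset.sum_congr rfl fun k hk => ?_
        simp [(Finset.ne_of_mem_erase hk).symm]
      · intro b _ hb
        simp [hb.symm]
      · simp
    · have h0 : ∀ x : Fin d, ((if i = x then (1 : ℂ) else 0) *
          star (if j = x then (1 : ℂ) else 0)) = 0 := by
        intro x
        by_cases h : i = x
        · subst h; simp [Ne.symm hij]
        · simp [h]
      simp only [blockMap, phiA, Matrix.vecMulVec_apply, Matrix.sum_apply, Matrix.add_apply,
        Matrix.of_apply, Matrix.smul_apply, Matrix.hadamard_apply, Matrix.submatrix_apply,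
        Pi.star_apply, smul_eq_mul, h0, hij]
      simp
end
end

section
/- Let d ≥ 2 and a ∈ ℝ. The linear map ψ : M_d(ℂ) → M_d(ℂ) defined by ψ(X) = (a+1)·ε(X) − X, where ε(X) is the diagonal matrix with the same diagonal entries as X, is completely positive if and only if a ≥ d − 1. -/
open Matrix BigOperators ComplexOrder

noncomputable section

/-- Projection onto the diagonal part, `ε(X)`. -/
def diagPart {d : ℕ} (X : Matrix (Fin d) (Fin d) ℂ) : Matrix (Fin d) (Fin d) ℂ :=
  Matrix.of fun i j => if i = j then X i i else 0

/-- coordinate weight -/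
def wt {n d : ℕ} (i : Fin d) (p : Fin n × Fin d) : ℂ := if p.2 = i then 1 else 0

lemma psd_conj {n d : ℕ} {ρ : Matrix (Fin n × Fin d) (Fin n × Fin d) ℂ} (h : ρ.PosSemidef)
    (w : Fin n × Fin d → ℂ) (hw : ∀ p, star (w p) = w p) :
    (Matrix.of fun p q => w p * ρ p q * w q).PosSemidef := by
  have h1 := h.conjTranspose_mul_mul_same (Matrix.diagonal w)
  convert h1 using 1
  ext p q
  rw [Matrix.diagonal_conjTranspose, Matrix.mul_diagonal, Matrix.diagonal_mul]
  simp only [Pi.star_apply, hw, Matrix.of_apply]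

lemma wt_star {n d : ℕ} (i : Fin d) (p : Fin n × Fin d) : star (wt i p) = wt i p := by
  unfold wt; split_ifs <;> simp

lemma wt_sum {n d : ℕ} (p : Fin n × Fin d) : ∑ i, wt i p = 1 := by
  simp [wt]

lemma wt_sum2 {n d : ℕ} (p q : Fin n × Fin d) :
    ∑ i, wt i p * wt i q = if p.2 = q.2 then 1 else 0 := by
  simp [wt, eq_comm]

lemma key_sum {n d : ℕ} (p q : Fin n × Fin d) :
    ∑ i, ∑ j, (wt i p - wt j p) * (wt i q - wt j q)
      = 2 * ((d : ℂ) * (if p.2 = q.2 then 1 else 0) - 1) := by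
  have e : ∀ i j : Fin d, (wt i p - wt j p) * (wt i q - wt j q)
      = wt i p * wt i q + wt j p * wt j q - wt i p * wt j q - wt i q * wt j p := by
    intros; ring
  simp only [e, Finset.sum_sub_distrib, Finset.sum_add_distrib, ← Finset.mul_sum, wt_sum, wt_sum2,
    Finset.sum_const, Finset.card_univ, Fintype.card_fin, mul_one, nsmul_eq_mul]
  have e3 : ∑ i, wt i p * ((d : ℂ) * wt i q) = d * (if p.2 = q.2 then 1 else 0) := by
    rw [← wt_sum2, Finset.mul_sum]
    exact Finset.sum_congr rfl fun i _ => by ring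
  rw [e3]
  ring

theorem stmt6 {d : ℕ} (hd : 2 ≤ d) (a : ℝ) :
    IsCP (fun X : Matrix (Fin d) (Fin d) ℂ => ((a : ℂ) + 1) • diagPart X - X) ↔
      (d : ℝ) - 1 ≤ a := by
  constructor
  · intro h
    have h1 := h 1 (Matrix.vecMulVec (fun _ => 1) (star fun _ => 1))
      (Matrix.posSemidef_vecMulVec_self_star _)
    have h2 := h1.dotProduct_mulVec_nonneg (fun _ => 1)
    have h3 : (0 : ℂ) ≤ (d : ℂ) * ((a + 1) - d) := by
      convert h2 using 1
      simp [dotProduct, Matrix.mulVec, blockMap, diagPart, Matrix.vecMulVec,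
        Fintype.sum_prod_type, Finset.sum_sub_distrib]
      try ring
    have h4 : (0 : ℝ) ≤ (d : ℝ) * ((a + 1) - d) := by exact_mod_cast h3
    have hd' : (0 : ℝ) < d := by positivity
    have := nonneg_of_mul_nonneg_right h4 hd'
    linarith
  · intro ha n ρ hρ
    have hc : (0 : ℂ) ≤ (((a + 1 - d : ℝ)) : ℂ) := by
      rw [Complex.zero_le_real]; linarith
    have hh : (0 : ℂ) ≤ (((1 / 2 : ℝ)) : ℂ) := by
      rw [Complex.zero_le_real]; norm_num
    have A : (∑ i : Fin d, Matrix.of fun p q => wt i p * ρ p q * wt i q).PosSemidef :=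
      Matrix.posSemidef_sum _ fun i _ => psd_conj hρ _ (wt_star i)
    have B : (∑ i : Fin d, ∑ j : Fin d, Matrix.of fun p q =>
        (wt i p - wt j p) * ρ p q * (wt i q - wt j q)).PosSemidef :=
      Matrix.posSemidef_sum _ fun i _ => Matrix.posSemidef_sum _ fun j _ =>
        psd_conj hρ (fun p => wt i p - wt j p) (fun p => by rw [star_sub, wt_star, wt_star])
    convert (A.smul hc).add (B.smul hh) using 1
    ext p q
    have hA : ∑ i : Fin d, wt i p * ρ p q * wt i q
        = ρ p q * (if p.2 = q.2 then 1 else 0) := by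
      rw [← wt_sum2, Finset.mul_sum]
      exact Finset.sum_congr rfl fun i _ => by ring
    have hB : ∑ i : Fin d, ∑ j : Fin d, (wt i p - wt j p) * ρ p q * (wt i q - wt j q)
        = ρ p q * (2 * ((d : ℂ) * (if p.2 = q.2 then 1 else 0) - 1)) := by
      rw [← key_sum, Finset.mul_sum]
      refine Finset.sum_congr rfl fun i _ => ?_
      rw [Finset.mul_sum]
      exact Finset.sum_congr rfl fun j _ => by ring
    simp only [Matrix.add_apply, Matrix.smul_apply, Matrix.sum_apply, Matrix.of_apply, hA, hB,
      blockMap, diagPart, Matrix.sub_apply, smul_eq_mul]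
    obtain ⟨p1, p2⟩ := p
    obtain ⟨q1, q2⟩ := q
    by_cases e : p2 = q2
    · subst e
      simp
      ring
    · simp [e]
      ring
end
end

section
/- Let d ≥ 2, let R be a real orthogonal (d−1)×(d−1) matrix, let λ ∈ ℝ, and define a_{ij} = 1/d + (λ/(d−1))·Σ_{α,β=1}^{d−1} (d_α)_{jj} R_{αβ} (d_β)_{ii}, where d_l (l = 1,…,d−1) are the diagonal Gell-Mann matrices. Then: (i) every row and every column of (a_{ij}) sums to 1; and (ii) for all i, j: Σ_{k=1}^d a_{ik} a_{jk} = (1/(d−1)²) · ( λ²·δ_{ij} + d − 2 + (1 − λ²)/d ). -/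
open Matrix BigOperators

noncomputable section

/-- Diagonal entry `j` of the diagonal Gell-Mann matrix `d_l` in `M_d(ℂ)`
(indexed by `l : Fin (d-1)`, corresponding to `l+1` in 1-based notation):
`d_l = (1/√(l(l+1))) (∑_{k=1}^{l} e_{kk} - l e_{l+1,l+1})`. -/
def gm (d : ℕ) (l : Fin (d - 1)) (j : Fin d) : ℝ :=
  (1 / Real.sqrt ((((l : ℕ) : ℝ) + 1) * (((l : ℕ) : ℝ) + 2))) *
    (if (j : ℕ) ≤ (l : ℕ) then (1 : ℝ)
     else if (j : ℕ) = (l : ℕ) + 1 then -(((l : ℕ) : ℝ) + 1) else 0)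

def uu (l j : ℕ) : ℝ :=
  if j ≤ l then (1 : ℝ) else if j = l + 1 then -((l : ℝ) + 1) else 0

def gg (l j : ℕ) : ℝ := (1 / Real.sqrt (((l : ℝ) + 1) * ((l : ℝ) + 2))) * uu l j

lemma gm_eq (d : ℕ) (l : Fin (d - 1)) (j : Fin d) : gm d l j = gg l j := rfl

lemma gg_mul (l i j : ℕ) :
    gg l i * gg l j = uu l i * uu l j / (((l : ℝ) + 1) * ((l : ℝ) + 2)) := by
  unfold gg
  have h : (0 : ℝ) ≤ ((l : ℝ) + 1) * ((l : ℝ) + 2) := by positivity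
  have h2 := Real.mul_self_sqrt h
  rw [div_eq_mul_inv _ (((l : ℝ) + 1) * ((l : ℝ) + 2))]
  conv_rhs => rw [← h2, mul_inv]
  ring

lemma uu_le {l j : ℕ} (h : j ≤ l) : uu l j = 1 := by simp [uu, h]
lemma uu_succ (l : ℕ) : uu l (l + 1) = -((l : ℝ) + 1) := by simp [uu]
lemma uu_gt {l j : ℕ} (h : l + 1 < j) : uu l j = 0 := by
  unfold uu; rw [if_neg (by omega), if_neg (by omega)]

lemma sum_uu (l k : ℕ) : ∑ j ∈ Finset.range (l + 2 + k), uu l j = 0 := by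
  induction k with
  | zero =>
    rw [add_zero, Finset.sum_range_succ, uu_succ,
      Finset.sum_congr rfl (g := fun _ => (1 : ℝ))
        (fun j hj => uu_le (by have := Finset.mem_range.1 hj; omega))]
    simp
  | succ k ih => rw [← add_assoc, Finset.sum_range_succ, ih, uu_gt (by omega)]; simp

lemma sum_uu2 (l k : ℕ) : ∑ j ∈ Finset.range (l + 2 + k), uu l j * uu l j
    = ((l : ℝ) + 1) * ((l : ℝ) + 2) := by
  induction k with
  | zero =>
    rw [add_zero, Finset.sum_range_succ, uu_succ,
      Finset.sum_congr rfl (g := fun _ => (1 : ℝ))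
        (fun j hj => by rw [uu_le (by have := Finset.mem_range.1 hj; omega)]; simp)]
    simp
    ring
  | succ k ih => rw [← add_assoc, Finset.sum_range_succ, ih, uu_gt (by omega)]; simp

lemma uu_mul_lt {l m : ℕ} (h : l < m) (j : ℕ) : uu l j * uu m j = uu l j := by
  by_cases hj : j ≤ m
  · rw [uu_le hj, mul_one]
  · rw [uu_gt (l := l) (by omega), zero_mul]

lemma gm_sum (d : ℕ) (l : Fin (d - 1)) : ∑ j, gm d l j = 0 := by
  simp only [gm_eq]
  rw [Fin.sum_univ_eq_sum_range (fun j => gg l j) d]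
  unfold gg
  rw [← Finset.mul_sum]
  have := l.2
  obtain ⟨k, hk⟩ : ∃ k, d = l + 2 + k := ⟨d - (l + 2), by omega⟩
  have h := sum_uu l k
  rw [← hk] at h
  rw [h, mul_zero]

lemma gg_lt (d l m : ℕ) (h : l < m) (hd : m + 1 < d) :
    ∑ j ∈ Finset.range d, gg l j * gg m j = 0 := by
  unfold gg
  obtain ⟨k, hk⟩ : ∃ k, d = l + 2 + k := ⟨d - (l + 2), by omega⟩
  have h' := sum_uu l k
  rw [← hk] at h'
  rw [Finset.sum_congr rfl (fun j _ => by rw [mul_mul_mul_comm, uu_mul_lt h]), ← Finset.mul_sum, h', mul_zero]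

lemma gm_orth (d : ℕ) (l m : Fin (d - 1)) :
    ∑ j, gm d l j * gm d m j = if l = m then 1 else 0 := by
  simp only [gm_eq]
  rw [Fin.sum_univ_eq_sum_range (fun j => gg l j * gg m j) d]
  have h1 := l.2
  have h2 := m.2
  rcases lt_trichotomy (l : ℕ) m with h | h | h
  · rw [if_neg (by intro e; simp [e] at h), gg_lt _ _ _ h (by omega)]
  · rw [if_pos (Fin.ext h), ← h]
    simp_rw [gg_mul]
    obtain ⟨k, hk⟩ : ∃ k, d = l + 2 + k := ⟨d - (l + 2), by omega⟩
    have h' := sum_uu2 l k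
    rw [← hk] at h'
    rw [← Finset.sum_div, h', div_self (by positivity)]
  · rw [if_neg (by intro e; simp [e] at h)]
    simp_rw [mul_comm (gg l _)]
    rw [gg_lt _ _ _ h (by omega)]

lemma gg_comp (n : ℕ) : ∀ i j, i ≤ n → j ≤ n → ∑ l ∈ Finset.range n, gg l i * gg l j
    = (if i = j then 1 else 0) - 1 / ((n : ℝ) + 1) := by
  induction n with
  | zero => intro i j hi hj; obtain rfl : i = 0 := by omega
            obtain rfl : j = 0 := by omega
            simp
  | succ n ih =>
    intro i j hi hj
    rw [Finset.sum_range_succ]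
    have z : ∀ i j, j = n + 1 → ∑ l ∈ Finset.range n, gg l i * gg l j = 0 := by
      intro i j hj
      apply Finset.sum_eq_zero
      intro l hl
      have := Finset.mem_range.1 hl
      rw [gg_mul, uu_gt (l := l) (j := j) (by omega)]; simp
    have p1 : (n : ℝ) + 1 ≠ 0 := by positivity
    have p2 : (n : ℝ) + 2 ≠ 0 := by positivity
    have p3 : (n : ℝ) + 1 + 1 ≠ 0 := by positivity
    push_cast
    rcases Nat.lt_or_ge n i with hi' | hi' <;> rcases Nat.lt_or_ge n j with hj' | hj'
    · obtain rfl : i = n + 1 := by omega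
      obtain rfl : j = n + 1 := by omega
      rw [z _ _ rfl, gg_mul, uu_succ, if_pos rfl]
      field_simp; ring
    · obtain rfl : i = n + 1 := by omega
      simp_rw [mul_comm (gg _ (n + 1))]
      rw [z _ _ rfl, gg_mul, uu_succ, uu_le hj', if_neg (by omega)]
      field_simp; ring
    · obtain rfl : j = n + 1 := by omega
      rw [z _ _ rfl, gg_mul, uu_succ, uu_le hi', if_neg (by omega)]
      field_simp; ring
    · rw [ih i j hi' hj', gg_mul, uu_le hi', uu_le hj']
      field_simp; ring

lemma gm_comp (d : ℕ) (i j : Fin d) :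
    ∑ l, gm d l i * gm d l j = (if i = j then 1 else 0) - 1 / (d : ℝ) := by
  simp only [gm_eq]
  rw [Fin.sum_univ_eq_sum_range (fun l => gg l i * gg l j) (d - 1)]
  have h1 := i.2
  have h2 := j.2
  rw [gg_comp (d - 1) i j (by omega) (by omega), Nat.cast_sub (by omega)]
  simp [Fin.ext_iff]

theorem stmt7 {d : ℕ} (hd : 2 ≤ d) (R : Matrix (Fin (d - 1)) (Fin (d - 1)) ℝ)
    (hR : R * Rᵀ = 1) (lam : ℝ) (a : Matrix (Fin d) (Fin d) ℝ)
    (haf : ∀ i j, a i j =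
      1 / d + lam / ((d : ℝ) - 1) * ∑ α, ∑ β, gm d α j * R α β * gm d β i) :
    ((∀ i, ∑ j, a i j = 1) ∧ (∀ j, ∑ i, a i j = 1)) ∧
      ∀ i j, ∑ m, a i m * a j m =
        1 / ((d : ℝ) - 1) ^ 2 *
          (lam ^ 2 * (if i = j then 1 else 0) + ((d : ℝ) - 2) + (1 - lam ^ 2) / d) := by
  have hRt : Rᵀ * R = 1 := mul_eq_one_comm.1 hR
  have hd0 : (d : ℝ) ≠ 0 := by positivity
  have hd1 : (d : ℝ) - 1 ≠ 0 := by
    have : (2 : ℝ) ≤ d := by exact_mod_cast hd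
    linarith
  let G : Matrix (Fin (d - 1)) (Fin d) ℝ := Matrix.of (gm d)
  have hGG : G * Gᵀ = 1 := by
    ext l m
    simp only [Matrix.mul_apply, Matrix.transpose_apply, Matrix.one_apply]
    exact gm_orth d l m
  let M : Matrix (Fin d) (Fin d) ℝ := Gᵀ * R * G
  have hM : ∀ i j, M j i = ∑ α, ∑ β, gm d α j * R α β * gm d β i := by
    intro i j
    simp only [M, Matrix.mul_apply, Finset.sum_mul]
    rw [Finset.sum_comm]
    rfl
  have ha : ∀ i j, a i j = 1 / d + lam / ((d : ℝ) - 1) * M j i := by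
    intro i j; rw [haf, hM]
  have hr : ∀ i, ∑ j, M j i = 0 := by
    intro i
    simp_rw [hM]
    rw [Finset.sum_comm]
    apply Finset.sum_eq_zero
    intro α _
    rw [Finset.sum_comm]
    apply Finset.sum_eq_zero
    intro β _
    rw [← Finset.sum_mul, ← Finset.sum_mul, gm_sum]; simp
  have hc : ∀ j, ∑ i, M j i = 0 := by
    intro j
    simp_rw [hM]
    rw [Finset.sum_comm]
    apply Finset.sum_eq_zero
    intro α _
    rw [Finset.sum_comm]
    apply Finset.sum_eq_zero
    intro β _
    rw [← Finset.mul_sum, gm_sum]; simp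
  have hMM : Mᵀ * M = Gᵀ * G := by
    have : Mᵀ * M = Gᵀ * (Rᵀ * ((G * Gᵀ) * (R * G))) := by
      simp only [M, Matrix.transpose_mul, Matrix.transpose_transpose, Matrix.mul_assoc]
    rw [this, hGG, Matrix.one_mul, ← Matrix.mul_assoc Rᵀ, hRt, Matrix.one_mul]
  have hq : ∀ i j, ∑ m, M m i * M m j = (if i = j then 1 else 0) - 1 / (d : ℝ) := by
    intro i j
    rw [← gm_comp]
    exact congrFun (congrFun hMM i) j
  refine ⟨⟨fun i => ?_, fun j => ?_⟩, fun i j => ?_⟩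
  · simp_rw [ha]
    rw [Finset.sum_add_distrib, ← Finset.mul_sum, hr]
    simp [hd0]
  · simp_rw [ha]
    rw [Finset.sum_add_distrib, ← Finset.mul_sum, hc]
    simp [hd0]
  · have e : ∀ m, a i m * a j m = 1 / (d : ℝ) * (1 / d)
        + 1 / (d : ℝ) * (lam / ((d : ℝ) - 1)) * M m i
        + 1 / (d : ℝ) * (lam / ((d : ℝ) - 1)) * M m j
        + (lam / ((d : ℝ) - 1)) ^ 2 * (M m i * M m j) := by
      intro m; rw [ha, ha]; ring
    simp_rw [e]
    rw [Finset.sum_add_distrib, Finset.sum_add_distrib, Finset.sum_add_distrib,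
      ← Finset.mul_sum, ← Finset.mul_sum, ← Finset.mul_sum, ← Finset.mul_sum, hr, hr, hq, Finset.sum_const,
      Finset.card_univ, Fintype.card_fin, nsmul_eq_mul]
    generalize (if i = j then (1 : ℝ) else 0) = t
    field_simp
    ring
end
end

section
/- Let 1 ≤ k ≤ d and let φ : M_d(ℂ) → M_d(ℂ) be a linear map. Then φ is k-positive (i.e., id_{M_k} ⊗ φ maps positive semidefinite matrices in M_k(ℂ) ⊗ M_d(ℂ) ≅ M_{kd}(ℂ) to positive semidefinite matrices) if and only if for every vector ψ ∈ ℂ^d ⊗ ℂ^d of Schmidt rank at most k, the matrix (id_{M_d} ⊗ φ)(|ψ⟩⟨ψ|) is positive semidefinite. -/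
open Matrix BigOperators ComplexOrder

noncomputable section

lemma exists_factor {d k : ℕ} (c : Matrix (Fin d) (Fin d) ℂ) (h : c.rank ≤ k) :
    ∃ (A : Matrix (Fin d) (Fin k) ℂ) (B : Matrix (Fin k) (Fin d) ℂ), c = A * B := by
  have h' : Module.finrank ℂ (LinearMap.range (Matrix.toLin' c)) ≤
      Module.finrank ℂ (Fin k → ℂ) := by
    rw [Module.finrank_fin_fun]
    exact h
  obtain ⟨f, hf⟩ := finrank_le_iff_exists_linearMap.1 h'
  obtain ⟨g, hg⟩ := LinearMap.exists_leftInverse_of_injective f (LinearMap.ker_eq_bot.2 hf)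
  refine ⟨LinearMap.toMatrix' ((LinearMap.range (Matrix.toLin' c)).subtype ∘ₗ g),
    LinearMap.toMatrix' (f ∘ₗ (Matrix.toLin' c).rangeRestrict), ?_⟩
  rw [← LinearMap.toMatrix'_comp]
  apply Matrix.toLin'.injective
  rw [Matrix.toLin'_toMatrix']
  refine LinearMap.ext fun x => ?_
  have := LinearMap.congr_fun hg ((Matrix.toLin' c).rangeRestrict x)
  simp only [LinearMap.comp_apply, LinearMap.id_apply] at this
  simp only [LinearMap.comp_apply, this]
  rfl

lemma blockMap_conj {d k : ℕ} (φ : Matrix (Fin d) (Fin d) ℂ →ₗ[ℂ] Matrix (Fin d) (Fin d) ℂ)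
    (A : Matrix (Fin d) (Fin k) ℂ) (B : Matrix (Fin k) (Fin d) ℂ) :
    blockMap ⇑φ (Matrix.vecMulVec (fun p : Fin d × Fin d => (A * B) p.1 p.2)
            (star fun p : Fin d × Fin d => (A * B) p.1 p.2)) =
    (Matrix.of fun (p : Fin d × Fin d) (q : Fin k × Fin d) =>
        A p.1 q.1 * if p.2 = q.2 then 1 else 0) *
      blockMap ⇑φ (Matrix.vecMulVec (fun p : Fin k × Fin d => B p.1 p.2)
            (star fun p : Fin k × Fin d => B p.1 p.2)) *
    (Matrix.of fun (p : Fin d × Fin d) (q : Fin k × Fin d) =>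
        A p.1 q.1 * if p.2 = q.2 then 1 else 0)ᴴ := by
  ext p q
  have key : (Matrix.of fun s t => Matrix.vecMulVec (fun p : Fin d × Fin d => (A * B) p.1 p.2)
            (star fun p : Fin d × Fin d => (A * B) p.1 p.2) (p.1, s) (q.1, t)) =
      ∑ b : Fin k, ∑ a : Fin k, (A p.1 a * star (A q.1 b)) • (Matrix.of fun s t =>
        Matrix.vecMulVec (fun p : Fin k × Fin d => B p.1 p.2)
            (star fun p : Fin k × Fin d => B p.1 p.2) (a, s) (b, t)) := by
    ext s t
    simp only [Matrix.of_apply, Matrix.vecMulVec_apply, Pi.star_apply, Matrix.mul_apply,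
      Matrix.sum_apply, Matrix.smul_apply, star_sum, Finset.sum_mul_sum, smul_eq_mul, star_mul']
    rw [Finset.sum_comm]
    refine Finset.sum_congr rfl fun b _ => Finset.sum_congr rfl fun a _ => ?_
    ring
  simp only [blockMap, Matrix.of_apply, key, map_sum, map_smul]
  simp only [Matrix.mul_apply, Matrix.sum_apply, Matrix.smul_apply, Matrix.conjTranspose_apply,
    Matrix.of_apply, Fintype.sum_prod_type, smul_eq_mul, star_mul', Finset.sum_mul]
  refine Finset.sum_congr rfl fun b _ => ?_
  simp [apply_ite, Finset.sum_ite_eq]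
  refine Finset.sum_congr rfl fun a _ => ?_
  ring

theorem stmt17 {d k : ℕ} (hk1 : 1 ≤ k) (hkd : k ≤ d)
    (φ : Matrix (Fin d) (Fin d) ℂ →ₗ[ℂ] Matrix (Fin d) (Fin d) ℂ) :
    (∀ ρ : Matrix (Fin k × Fin d) (Fin k × Fin d) ℂ,
        ρ.PosSemidef → (blockMap ⇑φ ρ).PosSemidef) ↔
      ∀ c : Matrix (Fin d) (Fin d) ℂ, c.rank ≤ k →
        (blockMap ⇑φ
          (Matrix.vecMulVec (fun p : Fin d × Fin d => c p.1 p.2)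
            (star fun p : Fin d × Fin d => c p.1 p.2))).PosSemidef := by
  constructor
  · intro H c hc
    obtain ⟨A, B, rfl⟩ := exists_factor c hc
    rw [blockMap_conj]
    exact (H _ (Matrix.posSemidef_vecMulVec_self_star _)).mul_mul_conjTranspose_same _
  · intro H ρ hρ
    obtain ⟨m, v, rfl⟩ := Matrix.posSemidef_iff_eq_sum_vecMulVec.1 hρ
    have e : blockMap ⇑φ (∑ i, Matrix.vecMulVec (v i) (star (v i))) =
        ∑ i, blockMap ⇑φ (Matrix.vecMulVec (v i) (star (v i))) := by
      ext p q
      have : (Matrix.of fun s t => (∑ i, Matrix.vecMulVec (v i) (star (v i))) (p.1, s) (q.1, t))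
          = ∑ i, Matrix.of fun s t => Matrix.vecMulVec (v i) (star (v i)) (p.1, s) (q.1, t) := by
        ext s t
        simp [Matrix.sum_apply]
      rw [blockMap, Matrix.of_apply, this, map_sum]
      simp only [blockMap, Matrix.of_apply, Matrix.sum_apply]
    rw [e]
    refine Matrix.posSemidef_sum _ fun i _ => ?_
    set A : Matrix (Fin d) (Fin k) ℂ :=
      (1 : Matrix (Fin d) (Fin d) ℂ).submatrix id (Fin.castLE hkd) with hA
    set B : Matrix (Fin k) (Fin d) ℂ := Matrix.of fun a b => v i (a, b) with hB
    have hAB : ∀ a b, (A * B) (Fin.castLE hkd a) b = v i (a, b) := by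
      intro a b
      simp [hA, hB, Matrix.mul_apply, Matrix.one_apply]
    have h1 := (H (A * B) ((Matrix.rank_mul_le_left A B).trans (Matrix.rank_le_width A))).submatrix
      (fun p : Fin k × Fin d => (Fin.castLE hkd p.1, p.2))
    convert h1 using 1
    ext p q
    simp [blockMap, Matrix.vecMulVec_apply, hAB]
end
end
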